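/- (Key estimate of the counterexample.) Let ψ, φ : ℝ → ℂ be Schwartz functions, ε_n := 2^{-(n^n)}, a_m := ε_{6m−1}^{−1}, and F(ξ) := Σ_{m=1}^∞ ψ(ξ − a_m). Then for every p ∈ ℕ there exists N ∈ ℕ such that for all n ≥ N, all ε ∈ (ε_{6n+3}, ε_{6n}], and all ξ ∈ ℝ, one has (1+ξ²)^{p/2} · |F(ξ)| · |(𝓕φ)(εξ)| ≤ ε^{−1}. -/

import Mathlib

open scoped FourierTransform

/-- The scale `ε_n = 2^{-(n^n)}`. -/
noncomputable def eps (n : ℕ) : ℝ := ((2 : ℝ) ^ (n ^ n))⁻¹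

/-- The translation points `a_m = ε_{6m-1}⁻¹ = 2^{((6m-1)^{6m-1})}`. -/
noncomputable def a (m : ℕ) : ℝ := (eps (6 * m - 1))⁻¹

/-- The sum `F(ξ) = Σ_{m=1}^∞ ψ(ξ − a_m)`. -/
noncomputable def F (ψ : SchwartzMap ℝ ℂ) (ξ : ℝ) : ℂ := ∑' m : ℕ, ψ (ξ - a (m + 1))

theorem SchwartzMap.exists_one_add_abs_pow_mul_le (f : SchwartzMap ℝ ℂ) (k : ℕ) :
    ∃ C : ℝ, 0 ≤ C ∧ ∀ x : ℝ, (1 + |x|) ^ k * ‖f x‖ ≤ C := by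
  have h (x : ℝ) := SchwartzMap.one_add_le_sup_seminorm_apply (𝕜 := ℝ) (m := (k, 0))
    (le_refl k) (le_refl 0) f x
  simp only [norm_iteratedFDeriv_zero, Real.norm_eq_abs] at h
  exact ⟨_, le_trans (by positivity) (h 0), h⟩

theorem pow_self_mono {m n : ℕ} (h : m ≤ n) : m ^ m ≤ n ^ n := by
  rcases Nat.eq_zero_or_pos n with rfl | hn
  · simp [Nat.le_zero.mp h]
  · exact (Nat.pow_le_pow_left h m).trans (Nat.pow_le_pow_right hn h)

theorem a_eq (m : ℕ) : a m = 2 ^ ((6 * m - 1) ^ (6 * m - 1)) := by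
  simp [a, eps]

theorem a_mono {m n : ℕ} (h : m ≤ n) : a m ≤ a n := by
  rw [a_eq, a_eq]
  exact pow_le_pow_right₀ one_le_two (pow_self_mono (by omega))

theorem one_le_a (m : ℕ) : 1 ≤ a m := by
  rw [a_eq]
  exact one_le_pow₀ one_le_two

theorem summable_inv_one_add_a : Summable fun m : ℕ => (1 + a (m + 1))⁻¹ := by
  refine Summable.of_nonneg_of_le (fun m => ?_) (fun m => ?_) summable_geometric_two
  · have := one_le_a (m + 1)
    positivity
  · rw [one_div, inv_pow, a_eq]
    refine inv_anti₀ (by positivity) ?_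
    have h : m ≤ (6 * (m + 1) - 1) ^ (6 * (m + 1) - 1) :=
      le_trans (by omega) (Nat.le_self_pow (by omega) _)
    have := pow_le_pow_right₀ (one_le_two (α := ℝ)) h
    linarith

/-- If the translates of `ψ` at `ξ` are dominated by `c / (1 + a_m)`, so is their sum. -/
theorem norm_F_le {ψ : SchwartzMap ℝ ℂ} {ξ c : ℝ}
    (h : ∀ m : ℕ, ‖ψ (ξ - a (m + 1))‖ ≤ c * (1 + a (m + 1))⁻¹) :
    ‖F ψ ξ‖ ≤ c * ∑' m : ℕ, (1 + a (m + 1))⁻¹ :=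
  tsum_of_norm_bounded (summable_inv_one_add_a.hasSum.mul_left c) h

theorem exists_norm_F_le (ψ : SchwartzMap ℝ ℂ) :
    ∃ C : ℝ, 0 ≤ C ∧ ∀ ξ : ℝ, ‖F ψ ξ‖ ≤ C * (1 + |ξ|) := by
  obtain ⟨C, hC, h⟩ := ψ.exists_one_add_abs_pow_mul_le 1
  have hS : 0 ≤ ∑' m : ℕ, (1 + a (m + 1))⁻¹ :=
    tsum_nonneg fun m => inv_nonneg.2 (by linarith [one_le_a (m + 1)])
  refine ⟨C * ∑' m : ℕ, (1 + a (m + 1))⁻¹, by positivity, fun ξ => ?_⟩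
  refine (norm_F_le (c := C * (1 + |ξ|)) fun m => ?_).trans_eq (by ring)
  have ha := one_le_a (m + 1)
  rw [← div_eq_mul_inv, le_div_iff₀ (by linarith)]
  have key := h (ξ - a (m + 1))
  rw [pow_one] at key
  have peetre : 1 + a (m + 1) ≤ (1 + |ξ|) * (1 + |ξ - a (m + 1)|) := by
    have h1 : a (m + 1) ≤ |ξ| + |ξ - a (m + 1)| := by
      linarith [le_abs_self ξ, neg_le_abs (ξ - a (m + 1))]
    nlinarith [mul_nonneg (abs_nonneg ξ) (abs_nonneg (ξ - a (m + 1)))]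
  calc ‖ψ (ξ - a (m + 1))‖ * (1 + a (m + 1))
      ≤ ‖ψ (ξ - a (m + 1))‖ * ((1 + |ξ|) * (1 + |ξ - a (m + 1)|)) := by gcongr
    _ = (1 + |ξ|) * ((1 + |ξ - a (m + 1)|) * ‖ψ (ξ - a (m + 1))‖) := by ring
    _ ≤ (1 + |ξ|) * C := by gcongr
    _ = C * (1 + |ξ|) := by ring

/-- Away from all the points `a_m`, the function `F` decays rapidly. -/
theorem exists_one_add_abs_pow_mul_norm_F_le (ψ : SchwartzMap ℝ ℂ) (p : ℕ) :
    ∃ C : ℝ, 0 ≤ C ∧ ∀ ξ : ℝ, (∀ m : ℕ, |ξ| ≤ 2 * |ξ - a (m + 1)|) →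
      (1 + |ξ|) ^ p * ‖F ψ ξ‖ ≤ C := by
  obtain ⟨C, hC, h⟩ := ψ.exists_one_add_abs_pow_mul_le (p + 1)
  have hS : 0 ≤ ∑' m : ℕ, (1 + a (m + 1))⁻¹ :=
    tsum_nonneg fun m => inv_nonneg.2 (by linarith [one_le_a (m + 1)])
  refine ⟨3 * 2 ^ p * C * ∑' m : ℕ, (1 + a (m + 1))⁻¹, by positivity, fun ξ hξ => ?_⟩
  have hpos : 0 < (1 + |ξ|) ^ p := by positivity
  rw [← le_div_iff₀' hpos]
  refine (norm_F_le (c := 3 * 2 ^ p * C / (1 + |ξ|) ^ p) fun m => ?_).trans_eq (by ring)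
  have ha := one_le_a (m + 1)
  rw [← div_eq_mul_inv, le_div_iff₀ (by linarith), le_div_iff₀ hpos]
  have key := h (ξ - a (m + 1))
  have hm := hξ m
  have h1 : 1 + a (m + 1) ≤ 3 * (1 + |ξ - a (m + 1)|) := by
    linarith [le_abs_self ξ, neg_le_abs (ξ - a (m + 1))]
  have h2 : 1 + |ξ| ≤ 2 * (1 + |ξ - a (m + 1)|) := by linarith
  calc ‖ψ (ξ - a (m + 1))‖ * (1 + a (m + 1)) * (1 + |ξ|) ^ p
      ≤ ‖ψ (ξ - a (m + 1))‖ * (3 * (1 + |ξ - a (m + 1)|)) *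
          (2 * (1 + |ξ - a (m + 1)|)) ^ p := by gcongr
    _ = 3 * 2 ^ p * ((1 + |ξ - a (m + 1)|) ^ (p + 1) * ‖ψ (ξ - a (m + 1))‖) := by
        rw [mul_pow]
        ring
    _ ≤ 3 * 2 ^ p * C := by gcongr

theorem one_add_sq_rpow_le (ξ : ℝ) (p : ℕ) :
    (1 + ξ ^ 2) ^ ((p : ℝ) / 2) ≤ (1 + |ξ|) ^ p := by
  calc (1 + ξ ^ 2) ^ ((p : ℝ) / 2) ≤ ((1 + |ξ|) ^ 2) ^ ((p : ℝ) / 2) := by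
        refine Real.rpow_le_rpow (by positivity) ?_ (by positivity)
        nlinarith [sq_abs ξ, abs_nonneg ξ]
    _ = (1 + |ξ|) ^ p := by
        rw [← Real.rpow_natCast_mul (by positivity), ← Real.rpow_natCast]
        congr 1
        push_cast
        ring

theorem abs_le_two_mul_abs_sub_a {n : ℕ} {ξ : ℝ} (h₁ : 2 * a n ≤ |ξ|)
    (h₂ : 2 * |ξ| ≤ a (n + 1)) (m : ℕ) : |ξ| ≤ 2 * |ξ - a (m + 1)| := by
  have ha := one_le_a (m + 1)
  rcases Nat.lt_or_ge m n with h | h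
  · have := a_mono (Nat.succ_le_of_lt h)
    have := abs_sub_abs_le_abs_sub ξ (a (m + 1))
    rw [abs_of_pos (by linarith : 0 < a (m + 1))] at this
    simp only [Nat.succ_eq_add_one] at *
    linarith
  · have := a_mono (Nat.succ_le_succ h)
    simp only [Nat.succ_eq_add_one] at *
    linarith [le_abs_self ξ, neg_le_abs (ξ - a (m + 1)), abs_nonneg ξ]

theorem two_le_eps_sq_mul_a (n : ℕ) : 2 ≤ eps (6 * n + 3) ^ 2 * a (n + 1) := by
  have h : 2 * (6 * n + 3) ^ (6 * n + 3) + 1 ≤ (6 * n + 5) ^ (6 * n + 5) := by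
    have h1 : 1 ≤ (6 * n + 3) ^ (6 * n + 3) := Nat.one_le_pow _ _ (by omega)
    calc 2 * (6 * n + 3) ^ (6 * n + 3) + 1 ≤ (6 * n + 3) ^ (6 * n + 3) * (6 * n + 5) := by
          nlinarith
      _ ≤ (6 * n + 5) ^ (6 * n + 3) * (6 * n + 5) := by
          gcongr
          omega
      _ = (6 * n + 5) ^ (6 * n + 4) := by ring
      _ ≤ (6 * n + 5) ^ (6 * n + 5) := Nat.pow_le_pow_right (by omega) (by omega)
  rw [a_eq, eps, show 6 * (n + 1) - 1 = 6 * n + 5 by omega, inv_pow, ← div_eq_inv_mul,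
    le_div_iff₀ (by positivity), ← pow_mul, ← pow_succ']
  exact pow_le_pow_right₀ one_le_two (by omega)

theorem exists_mul_a_pow_le (M : ℝ) (q : ℕ) :
    ∃ N : ℕ, ∀ n : ℕ, N ≤ n → M * a n ^ q ≤ (eps (6 * n))⁻¹ := by
  obtain ⟨k, hk⟩ := pow_unbounded_of_one_lt M (one_lt_two (α := ℝ))
  refine ⟨k + q + 1, fun n hn => ?_⟩
  have hle : k + (6 * n - 1) ^ (6 * n - 1) * q ≤ (6 * n) ^ (6 * n) := by
    have h1 : 1 ≤ (6 * n) ^ (6 * n - 1) := Nat.one_le_pow _ _ (by omega)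
    have h2 : (6 * n - 1) ^ (6 * n - 1) ≤ (6 * n) ^ (6 * n - 1) :=
      Nat.pow_le_pow_left (by omega) _
    calc k + (6 * n - 1) ^ (6 * n - 1) * q
        ≤ k * (6 * n) ^ (6 * n - 1) + (6 * n) ^ (6 * n - 1) * q := by
          gcongr
          exact Nat.le_mul_of_pos_right k h1
      _ = (6 * n) ^ (6 * n - 1) * (k + q) := by ring
      _ ≤ (6 * n) ^ (6 * n - 1) * (6 * n) := by
          gcongr
          omega
      _ = (6 * n) ^ (6 * n) := by rw [← pow_succ, Nat.sub_add_cancel (by omega)]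
  rw [eps, inv_inv, a_eq, ← pow_mul]
  calc M * (2 : ℝ) ^ ((6 * n - 1) ^ (6 * n - 1) * q)
      ≤ 2 ^ k * 2 ^ ((6 * n - 1) ^ (6 * n - 1) * q) := by gcongr
    _ = 2 ^ (k + (6 * n - 1) ^ (6 * n - 1) * q) := by rw [pow_add]
    _ ≤ 2 ^ ((6 * n) ^ (6 * n)) := pow_le_pow_right₀ one_le_two hle

/-- Key estimate: for every `p` there is `N` such that for all `n ≥ N`, all
`ε ∈ (ε_{6n+3}, ε_{6n}]` and all `ξ`, `⟨ξ⟩^p |F(ξ)| |(𝓕φ)(εξ)| ≤ ε⁻¹`. -/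
theorem stmt13 (ψ φ : SchwartzMap ℝ ℂ) :
    ∀ p : ℕ, ∃ N : ℕ, ∀ n : ℕ, N ≤ n → ∀ ε : ℝ, eps (6 * n + 3) < ε → ε ≤ eps (6 * n) →
      ∀ ξ : ℝ, (1 + ξ ^ 2) ^ ((p : ℝ) / 2) * ‖F ψ ξ‖ * ‖𝓕 (⇑φ) (ε * ξ)‖ ≤ ε⁻¹ := by
  intro p
  obtain ⟨A, hA, hF⟩ := exists_norm_F_le ψ
  obtain ⟨B, hB, hFmid⟩ := exists_one_add_abs_pow_mul_norm_F_le ψ p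
  obtain ⟨D, hD, hφ⟩ := (𝓕 φ).exists_one_add_abs_pow_mul_le 0
  obtain ⟨K, hK, hφ'⟩ := (𝓕 φ).exists_one_add_abs_pow_mul_le (2 * (p + 1))
  rw [SchwartzMap.fourier_coe] at hφ hφ'
  simp only [pow_zero, one_mul] at hφ
  obtain ⟨N, hN⟩ := exists_mul_a_pow_le
    (A * 3 ^ (p + 1) * D + B * D + A * 2 ^ (p + 1) * K) (p + 1)
  refine ⟨N, fun n hn ε hε₁ hε₂ ξ => ?_⟩
  have heps : 0 < eps (6 * n + 3) := by unfold eps; positivity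
  have hε : 0 < ε := heps.trans hε₁
  have ha := one_le_a n
  have hap : 1 ≤ a n ^ (p + 1) := one_le_pow₀ ha
  refine le_trans ?_ ((hN n hn).trans (inv_anti₀ hε hε₂))
  have hlow : 0 ≤ A * 3 ^ (p + 1) * D := by positivity
  have hmid : 0 ≤ B * D := by positivity
  have hhigh : 0 ≤ A * 2 ^ (p + 1) * K := by positivity
  set G := ‖𝓕 (⇑φ) (ε * ξ)‖ with hG
  have hG₀ : 0 ≤ G := norm_nonneg _
  have hGD : G ≤ D := hφ (ε * ξ)
  have hbracket : (1 + ξ ^ 2) ^ ((p : ℝ) / 2) * ‖F ψ ξ‖ * G ≤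
      (1 + |ξ|) ^ p * ‖F ψ ξ‖ * G := by
    gcongr
    exact one_add_sq_rpow_le ξ p
  have hcrude : (1 + |ξ|) ^ p * ‖F ψ ξ‖ * G ≤ A * ((1 + |ξ|) ^ (p + 1) * G) :=
    calc (1 + |ξ|) ^ p * ‖F ψ ξ‖ * G ≤ (1 + |ξ|) ^ p * (A * (1 + |ξ|)) * G := by
          gcongr
          exact hF ξ
      _ = A * ((1 + |ξ|) ^ (p + 1) * G) := by ring
  refine hbracket.trans ?_
  rcases le_total |ξ| (2 * a n) with h₁ | h₁
  · calc (1 + |ξ|) ^ p * ‖F ψ ξ‖ * G ≤ A * ((1 + |ξ|) ^ (p + 1) * G) := hcrude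
      _ ≤ A * ((3 * a n) ^ (p + 1) * D) := by
          gcongr
          linarith
      _ = A * 3 ^ (p + 1) * D * a n ^ (p + 1) := by ring
      _ ≤ _ := by
          gcongr
          linarith
  rcases le_total (2 * |ξ|) (a (n + 1)) with h₂ | h₂
  · calc (1 + |ξ|) ^ p * ‖F ψ ξ‖ * G ≤ B * D := by
          gcongr
          exact hFmid ξ (abs_le_two_mul_abs_sub_a h₁ h₂)
      _ ≤ A * 3 ^ (p + 1) * D + B * D + A * 2 ^ (p + 1) * K := by linarith
      _ ≤ _ := le_mul_of_one_le_right (by positivity) hap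
  · have hsq : 1 ≤ ε ^ 2 * |ξ| := by
      have h3 : eps (6 * n + 3) ^ 2 * a (n + 1) ≤ ε ^ 2 * (2 * |ξ|) := by
        have := one_le_a (n + 1)
        gcongr
      linarith [two_le_eps_sq_mul_a n]
    have hξ : 1 + |ξ| ≤ 2 * (1 + |ε * ξ|) ^ 2 := by
      rw [abs_mul, abs_of_pos hε]
      nlinarith [mul_le_mul_of_nonneg_right hsq (abs_nonneg ξ), mul_nonneg hε.le (abs_nonneg ξ)]
    calc (1 + |ξ|) ^ p * ‖F ψ ξ‖ * G ≤ A * ((1 + |ξ|) ^ (p + 1) * G) := hcrude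
      _ ≤ A * ((2 * (1 + |ε * ξ|) ^ 2) ^ (p + 1) * G) := by gcongr
      _ = A * 2 ^ (p + 1) * ((1 + |ε * ξ|) ^ (2 * (p + 1)) * G) := by
          rw [mul_pow, ← pow_mul]
          ring
      _ ≤ A * 2 ^ (p + 1) * K := by
          gcongr
          exact hφ' (ε * ξ)
      _ ≤ A * 3 ^ (p + 1) * D + B * D + A * 2 ^ (p + 1) * K := by linarith
      _ ≤ _ := le_mul_of_one_le_right (by positivity) hap
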